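/- Let (X,d,m) be a metric measure space with (X,d) proper that has the deformation property, let E ⊆ X be a set of locally finite perimeter, and let B ⊆ X be a bounded set. Then there exist R ∈ (0,1] and C ≥ 0, depending only on B and E, such that for every x ∈ B, every y ∈ B_R(x) and every r ∈ (0,R) the two deformation inequalities hold with these constants: P(E \ B_r(y), B_{2R}(x)) ≤ C·m(B_r(y)∩E)/r + P(E, B_{2R}(x)) and P(E ∪ B_r(y), B_{2R}(x)) ≤ C·m(B_r(y)\E)/r + P(E, B_{2R}(x)). In particular inf_{x∈B} R_x(E) > 0, where R_x(E) is the maximal radius in (0,1] for which the deformation inequalities hold at x with some constant. -/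

import Mathlib

open MeasureTheory Metric Set Filter Topology ENNReal Bornology
open scoped symmDiff

noncomputable section

variable {X : Type*}

/-- The slope (pointwise Lipschitz constant) of `f` at `x`, computed within `Ω`.
It vanishes at points that are isolated in `Ω`. -/
def slopeOn [MetricSpace X] (Ω : Set X) (f : X → ℝ) (x : X) : ℝ≥0∞ :=
  Filter.limsup (fun y => ENNReal.ofReal (|f x - f y| / dist x y)) (𝓝[Ω \ {x}] x)

/-- The slope of `f`. -/
def mSlope [MetricSpace X] (f : X → ℝ) (x : X) : ℝ≥0∞ := slopeOn Set.univ f x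

/-- `f` is locally Lipschitz on `Ω`. -/
def LocLipOn [MetricSpace X] (Ω : Set X) (f : X → ℝ) : Prop :=
  ∀ x ∈ Ω, ∃ r > (0:ℝ), ∃ K : NNReal, LipschitzOnWith K f (Metric.ball x r ∩ Ω)

/-- Convergence `fn → f` in `L¹_loc(Ω)` w.r.t. the measure `m`. -/
def TendstoL1loc [MetricSpace X] [MeasurableSpace X] (m : Measure X) (Ω : Set X)
    (fn : ℕ → X → ℝ) (f : X → ℝ) : Prop :=
  ∀ K : Set X, K ⊆ Ω → IsCompact K →
    Tendsto (fun n => ∫⁻ x in K, ENNReal.ofReal |fn n x - f x| ∂m) atTop (𝓝 0)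

/-- The total variation `|Df|(B)` of `f : X → ℝ` on the set `B`. -/
def totVar [MetricSpace X] [MeasurableSpace X] (m : Measure X) (f : X → ℝ) (B : Set X) : ℝ≥0∞ :=
  ⨅ (Ω : Set X) (_ : IsOpen Ω) (_ : B ⊆ Ω),
    ⨅ (fn : ℕ → X → ℝ) (_ : ∀ n, LocLipOn Ω (fn n)) (_ : TendstoL1loc m Ω fn f),
      Filter.liminf (fun n => ∫⁻ x in Ω, slopeOn Ω (fn n) x ∂m) atTop

/-- The perimeter `P(E, B)` of a set `E` in `B`. -/
def Per [MetricSpace X] [MeasurableSpace X] (m : Measure X) (E B : Set X) : ℝ≥0∞ :=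
  totVar m (Set.indicator E fun _ => (1:ℝ)) B

/-- `E` has locally finite perimeter. -/
def HasLocFinPer [MetricSpace X] [MeasurableSpace X] (m : Measure X) (E : Set X) : Prop :=
  ∀ x : X, ∃ r > (0:ℝ), Per m E (Metric.ball x r) < ∞

/-- `E` has finite perimeter. -/
def HasFinPer [MetricSpace X] [MeasurableSpace X] (m : Measure X) (E : Set X) : Prop :=
  Per m E Set.univ < ∞

/-- `m` is finite on bounded sets. -/
def BoundedlyFinite [MetricSpace X] [MeasurableSpace X] (m : Measure X) : Prop :=
  ∀ B : Set X, Bornology.IsBounded B → m B < ∞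

/-- Uniformly locally doubling with doubling function `C_D`. -/
def UnifLocDoublingWith [MetricSpace X] [MeasurableSpace X] (C_D : ℝ → ℝ) (m : Measure X) : Prop :=
  ∀ R : ℝ, 0 < R → ∀ x : X, ∀ r : ℝ, 0 < r → r < R →
    m (Metric.ball x (2 * r)) ≤ ENNReal.ofReal (C_D R) * m (Metric.ball x r)

/-- Weak local (1,1)-Poincaré inequality with dilation `lam` and constant function `C_P`. -/
def WeakPoincareWith [MetricSpace X] [MeasurableSpace X] (lam : ℝ) (C_P : ℝ → ℝ)
    (m : Measure X) : Prop :=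
  ∀ f : X → ℝ, LocLipOn Set.univ f → ∀ R : ℝ, 0 < R → ∀ x : X, ∀ r : ℝ, 0 < r → r < R →
    (∫⁻ y in Metric.ball x r,
        ENNReal.ofReal |f y - ⨍ z in Metric.ball x r, f z ∂m| ∂m) / m (Metric.ball x r)
      ≤ ENNReal.ofReal (C_P R * r) *
          ((∫⁻ y in Metric.ball x (lam * r), mSlope f y ∂m) / m (Metric.ball x (lam * r)))

/-- `(X, d, m)` is a PI space. -/
def IsPIspace [MetricSpace X] [MeasurableSpace X] (m : Measure X) : Prop :=
  (∃ C_D : ℝ → ℝ, (∀ R, 0 < R → 0 < C_D R) ∧ UnifLocDoublingWith C_D m) ∧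
  (∃ lam : ℝ, 1 ≤ lam ∧ ∃ C_P : ℝ → ℝ, (∀ R, 0 < R → 0 < C_P R) ∧ WeakPoincareWith lam C_P m)

/-- `(X, d)` is a length space: the distance between two points is the infimum of the
lengths of continuous curves joining them. -/
def IsLengthSpace (X : Type*) [MetricSpace X] : Prop :=
  ∀ p q : X, ENNReal.ofReal (dist p q) =
    ⨅ (γ : ℝ → X) (_ : ContinuousOn γ (Set.Icc 0 1)) (_ : γ 0 = p) (_ : γ 1 = q),
      eVariationOn γ (Set.Icc 0 1)

/-- Essential interior `E^{(1)}`. -/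
def essInt [MetricSpace X] [MeasurableSpace X] (m : Measure X) (E : Set X) : Set X :=
  { x | Tendsto (fun r : ℝ => m (E ∩ Metric.ball x r) / m (Metric.ball x r)) (𝓝[>] 0) (𝓝 1) }

/-- Essential exterior `E^{(0)}`. -/
def essExt [MetricSpace X] [MeasurableSpace X] (m : Measure X) (E : Set X) : Set X :=
  { x | Tendsto (fun r : ℝ => m (E ∩ Metric.ball x r) / m (Metric.ball x r)) (𝓝[>] 0) (𝓝 0) }

/-- Essential boundary `∂^e E`. -/
def essBdry [MetricSpace X] [MeasurableSpace X] (m : Measure X) (E : Set X) : Set X :=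
  (essInt m E ∪ essExt m E)ᶜ

/-- The two deformation inequalities hold for `E` at `x` with radius `R` and constant `C`. -/
def DeformIneq [MetricSpace X] [MeasurableSpace X] (m : Measure X) (E : Set X) (x : X)
    (R C : ℝ) : Prop :=
  ∀ y ∈ Metric.ball x R, ∀ r ∈ Set.Ioo (0:ℝ) R,
    Per m (E \ Metric.ball y r) (Metric.ball x (2 * R)) ≤
      ENNReal.ofReal C * m (Metric.ball y r ∩ E) / ENNReal.ofReal r +
        Per m E (Metric.ball x (2 * R)) ∧
    Per m (E ∪ Metric.ball y r) (Metric.ball x (2 * R)) ≤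
      ENNReal.ofReal C * m (Metric.ball y r \ E) / ENNReal.ofReal r +
        Per m E (Metric.ball x (2 * R))

/-- The deformation inequalities hold for `E` at `x` with radius `R` and some constant. -/
def DeformAt [MetricSpace X] [MeasurableSpace X] (m : Measure X) (E : Set X) (x : X)
    (R : ℝ) : Prop :=
  0 < R ∧ R ≤ 1 ∧ ∃ C : ℝ, 0 ≤ C ∧ DeformIneq m E x R C

/-- `R_x(E)`: the maximal radius in `(0,1]` for which the deformation inequalities hold. -/
def deformRadius [MetricSpace X] [MeasurableSpace X] (m : Measure X) (E : Set X) (x : X) : ℝ :=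
  sSup { R : ℝ | DeformAt m E x R }

/-- `(X, d, m)` has the deformation property. -/
def DeformationProperty [MetricSpace X] [MeasurableSpace X] (m : Measure X) : Prop :=
  ∀ E : Set X, MeasurableSet E → HasLocFinPer m E → ∀ x : X, ∃ R : ℝ, DeformAt m E x R

/-- `E` is a volume-constrained minimizer of the perimeter. -/
def VolConstMin [MetricSpace X] [MeasurableSpace X] (m : Measure X) (E : Set X) : Prop :=
  MeasurableSet E ∧ HasLocFinPer m E ∧
    ∀ F K : Set X, MeasurableSet F → IsCompact K →
      m ((E ∆ F) \ K) = 0 → m (E ∩ K) = m (F ∩ K) → Per m E K ≤ Per m F K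

/-- `E` is an isoperimetric set. -/
def IsIsoperimetricSet [MetricSpace X] [MeasurableSpace X] (m : Measure X) (E : Set X) : Prop :=
  MeasurableSet E ∧ HasFinPer m E ∧ 0 < m E ∧ m E < ∞ ∧
    ∀ F : Set X, MeasurableSet F → m F = m E → Per m E Set.univ ≤ Per m F Set.univ


theorem ENNReal.limsup_add_le_add_limsup {α : Type*} {F : Filter α} (u v : α → ℝ≥0∞) :
    limsup (fun x => u x + v x) F ≤ limsup u F + limsup v F := by
  refine ENNReal.le_of_forall_pos_le_add fun ε hε hfin => ?_
  have hε' : ((ε : ℝ≥0∞) / 2) ≠ 0 := by simp [hε.ne']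
  obtain ⟨hu, hv⟩ := ENNReal.add_lt_top.1 hfin
  have h1 := eventually_lt_of_limsup_lt (ENNReal.lt_add_right hu.ne hε')
  have h2 := eventually_lt_of_limsup_lt (ENNReal.lt_add_right hv.ne hε')
  refine limsup_le_of_le (h := ?_)
  filter_upwards [h1, h2] with x hx1 hx2
  calc u x + v x ≤ (limsup u F + ε / 2) + (limsup v F + ε / 2) := add_le_add hx1.le hx2.le
    _ = limsup u F + limsup v F + (ε / 2 + ε / 2) := by ring
    _ = _ := by rw [ENNReal.add_halves]

section Slope

variable [MetricSpace X]

theorem slopeOn_mono {Ω Ω' : Set X} (h : Ω ⊆ Ω') (f : X → ℝ) (x : X) :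
    slopeOn Ω f x ≤ slopeOn Ω' f x :=
  limsup_le_limsup_of_le (nhdsWithin_mono _ (sdiff_subset_sdiff_left h))

theorem LocLipOn.mono {Ω Ω' : Set X} {f : X → ℝ} (hf : LocLipOn Ω' f) (h : Ω ⊆ Ω') :
    LocLipOn Ω f := fun x hx => by
  obtain ⟨r, hr, K, hK⟩ := hf x (h hx)
  exact ⟨r, hr, K, hK.mono (inter_subset_inter_right _ h)⟩

theorem LocLipOn.continuousOn {Ω : Set X} {f : X → ℝ} (hf : LocLipOn Ω f) :
    ContinuousOn f Ω := fun x hx => by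
  obtain ⟨r, hr, K, hK⟩ := hf x hx
  refine (hK.continuousOn x ⟨mem_ball_self hr, hx⟩).mono_of_mem_nhdsWithin ?_
  exact inter_mem (mem_nhdsWithin_of_mem_nhds (ball_mem_nhds x hr)) self_mem_nhdsWithin

theorem measurable_indicator_slopeOn [MeasurableSpace X] [BorelSpace X] {Ω : Set X}
    (hΩ : IsOpen Ω) {f : X → ℝ} (hf : ContinuousOn f Ω) :
    Measurable (Ω.indicator (slopeOn Ω f)) := by
  have key : Ω.indicator (slopeOn Ω f) = fun x => ⨅ n : ℕ, ⨆ y ∈ Ω,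
      (Ω ∩ (ball y (1 / ((n : ℝ) + 1)) \ {y})).indicator
        (fun x => ENNReal.ofReal (|f x - f y| / dist x y)) x := by
    ext x
    by_cases hx : x ∈ Ω
    · rw [indicator_of_mem hx, slopeOn, ((nhdsWithin_hasBasis nhds_basis_ball_inv_nat_succ
        (Ω \ {x}))).limsup_eq_iInf_iSup]
      simp only [iInf_true]
      refine iInf_congr fun n => le_antisymm ?_ ?_
      · refine iSup₂_le fun y hy => ?_
        refine le_iSup₂_of_le y hy.2.1 ?_
        rw [indicator_of_mem]
        exact ⟨hx, mem_ball_comm.1 hy.1, fun h => hy.2.2 (by simpa using h.symm)⟩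
      · refine iSup₂_le fun y hy => ?_
        by_cases h : x ∈ Ω ∩ (ball y (1 / ((n : ℝ) + 1)) \ {y})
        · rw [indicator_of_mem h]
          exact le_iSup₂_of_le (f := fun y (_ : y ∈ _) =>
            ENNReal.ofReal (|f x - f y| / dist x y)) y
            ⟨mem_ball_comm.1 h.2.1, hy, fun h' => h.2.2 (by simpa using h'.symm)⟩ le_rfl
        · rw [indicator_of_notMem h]
          exact zero_le
    · rw [indicator_of_notMem hx]
      refine (le_antisymm ((iInf_le _ 0).trans ?_) zero_le).symm
      refine iSup₂_le fun y _ => ?_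
      rw [indicator_of_notMem fun h => hx h.1]
  rw [key]
  refine Measurable.iInf fun n => LowerSemicontinuous.measurable ?_
  refine lowerSemicontinuous_biSup fun y _ => ?_
  have hO : IsOpen (Ω ∩ (ball y (1 / ((n : ℝ) + 1)) \ {y})) :=
    hΩ.inter (isOpen_ball.sdiff isClosed_singleton)
  rw [lowerSemicontinuous_iff_isOpen_preimage]
  intro c
  have hc : ContinuousOn (fun x => ENNReal.ofReal (|f x - f y| / dist x y))
      (Ω ∩ (ball y (1 / ((n : ℝ) + 1)) \ {y})) := by
    refine ENNReal.continuous_ofReal.comp_continuousOn (ContinuousOn.div ?_ (by fun_prop) ?_)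
    · exact ((hf.mono inter_subset_left).sub continuousOn_const).abs
    · exact fun z hz => dist_ne_zero.2 fun h => hz.2.2 h
  convert hc.isOpen_inter_preimage hO (isOpen_Ioi (a := c)) using 1
  ext z
  by_cases hz : z ∈ Ω ∩ (ball y (1 / ((n : ℝ) + 1)) \ {y})
  · rw [mem_preimage, indicator_of_mem hz]
    exact ⟨fun h => ⟨hz, h⟩, fun h => h.2⟩
  · rw [mem_preimage, indicator_of_notMem hz]
    exact ⟨fun h => absurd (mem_Ioi.1 h) _root_.not_lt_zero, fun h => absurd h.1 hz⟩

theorem slopeOn_le_of_eqOn_nhds {W Ω : Set X} {h f : X → ℝ} {x : X} (hx : x ∈ Ω)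
    (hΩ : IsOpen Ω) (hfh : h =ᶠ[𝓝 x] f) : slopeOn W h x ≤ slopeOn Ω f x := by
  refine (limsup_congr (v := fun y => ENNReal.ofReal (|f x - f y| / dist x y)) ?_).trans_le
    (limsup_le_limsup_of_le ?_)
  · filter_upwards [mem_nhdsWithin_of_mem_nhds hfh] with y hy
    rw [hfh.self_of_nhds, hy]
  · refine nhdsWithin_le_iff.2 ?_
    filter_upwards [mem_nhdsWithin_of_mem_nhds (hΩ.mem_nhds hx), self_mem_nhdsWithin] with y h1 h2
    exact ⟨h1, h2.2⟩

end Slope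

/-- The Lipschitz cutoff equal to `1` on `closedBall y a` and to `0` outside `ball y b`. -/
def cutoff [MetricSpace X] (y : X) (a b : ℝ) (z : X) : ℝ :=
  max 0 (min 1 ((b - dist z y) / (b - a)))

/-- The interpolation between `f` near `y` and `g` away from `y`. -/
def glue [MetricSpace X] (y : X) (a b : ℝ) (f g : X → ℝ) (z : X) : ℝ :=
  cutoff y a b z * f z + (1 - cutoff y a b z) * g z

section Glue

variable [MetricSpace X] {y : X} {a b : ℝ} {f g : X → ℝ}

theorem cutoff_nonneg (z : X) : 0 ≤ cutoff y a b z := le_max_left _ _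

theorem cutoff_le_one (z : X) : cutoff y a b z ≤ 1 :=
  max_le zero_le_one (min_le_left _ _)

theorem cutoff_eq_one (hab : a < b) {z : X} (hz : dist z y ≤ a) : cutoff y a b z = 1 := by
  have : 1 ≤ (b - dist z y) / (b - a) := by
    rw [le_div_iff₀ (sub_pos.2 hab)]; linarith
  simp [cutoff, min_eq_left this]

theorem cutoff_eq_zero (hab : a < b) {z : X} (hz : b ≤ dist z y) : cutoff y a b z = 0 := by
  have : (b - dist z y) / (b - a) ≤ 0 :=
    div_nonpos_of_nonpos_of_nonneg (by linarith) (by linarith)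
  exact max_eq_left ((min_le_right _ _).trans this)

theorem abs_cutoff_sub_le (hab : a < b) (z w : X) :
    |cutoff y a b z - cutoff y a b w| ≤ 1 / (b - a) * dist z w := by
  have h0 := sub_pos.2 hab
  refine (abs_max_sub_max_le_max _ _ _ _).trans ?_
  rw [sub_self, abs_zero]
  refine max_le (by positivity) ((abs_min_sub_min_le_max _ _ _ _).trans ?_)
  rw [sub_self, abs_zero]
  refine max_le (by positivity) ?_
  rw [← sub_div, abs_div, abs_of_pos h0, one_div, div_eq_inv_mul]
  refine mul_le_mul_of_nonneg_left ?_ (by positivity)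
  have e : b - dist z y - (b - dist w y) = dist w y - dist z y := by ring
  rw [e, dist_comm z w]
  exact abs_dist_sub_le w z y

theorem glue_eq_left (hab : a < b) {z : X} (hz : dist z y ≤ a) : glue y a b f g z = f z := by
  simp [glue, cutoff_eq_one hab hz]

theorem glue_eq_right (hab : a < b) {z : X} (hz : b ≤ dist z y) : glue y a b f g z = g z := by
  simp [glue, cutoff_eq_zero hab hz]

theorem glue_eventuallyEq_left (hab : a < b) {z : X} (hz : dist z y < a) :
    glue y a b f g =ᶠ[𝓝 z] f := by
  filter_upwards [isOpen_ball.mem_nhds (mem_ball.2 hz)] with w hw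
  exact glue_eq_left hab (mem_ball.1 hw).le

theorem glue_eventuallyEq_right (hab : a < b) {z : X} (hz : b < dist z y) :
    glue y a b f g =ᶠ[𝓝 z] g := by
  have : IsOpen {w | b < dist w y} := isOpen_lt (by fun_prop) (by fun_prop)
  filter_upwards [this.mem_nhds hz] with w hw
  exact glue_eq_right hab (le_of_lt hw)

theorem abs_glue_sub_glue_le (hab : a < b) (p q : X) :
    |glue y a b f g p - glue y a b f g q| ≤
      |f p - f q| + |g p - g q| + 1 / (b - a) * |f p - g p| * dist p q := by
  have h1 := abs_cutoff_sub_le (y := y) hab p q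
  have h2 := cutoff_nonneg (y := y) (a := a) (b := b) q
  have h3 := cutoff_le_one (y := y) (a := a) (b := b) q
  have e : glue y a b f g p - glue y a b f g q =
      cutoff y a b q * (f p - f q) + (1 - cutoff y a b q) * (g p - g q)
      + (cutoff y a b p - cutoff y a b q) * (f p - g p) := by
    simp only [glue]; ring
  rw [e]
  refine (abs_add_three _ _ _).trans ?_
  rw [abs_mul, abs_mul, abs_mul, abs_of_nonneg h2, abs_of_nonneg (sub_nonneg.2 h3)]
  have i1 : cutoff y a b q * |f p - f q| ≤ |f p - f q| :=
    mul_le_of_le_one_left (abs_nonneg _) h3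
  have i2 : (1 - cutoff y a b q) * |g p - g q| ≤ |g p - g q| :=
    mul_le_of_le_one_left (abs_nonneg _) (by linarith)
  have i3 := mul_le_mul_of_nonneg_right h1 (abs_nonneg (f p - g p))
  nlinarith

theorem slopeOn_glue_le {W Ω₁ Ω₂ : Set X} (hab : a < b) {x : X} (h1 : IsOpen Ω₁) (h2 : IsOpen Ω₂)
    (hx1 : x ∈ Ω₁) (hx2 : x ∈ Ω₂) :
    slopeOn W (glue y a b f g) x ≤ slopeOn Ω₁ f x + (slopeOn Ω₂ g x
      + ENNReal.ofReal (1 / (b - a)) * ENNReal.ofReal |f x - g x|) := by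
  have h0 : 0 < 1 / (b - a) := one_div_pos.2 (sub_pos.2 hab)
  have step : slopeOn W (glue y a b f g) x ≤ limsup (fun z =>
      ENNReal.ofReal (|f x - f z| / dist x z) + (ENNReal.ofReal (|g x - g z| / dist x z)
        + ENNReal.ofReal (1 / (b - a)) * ENNReal.ofReal |f x - g x|)) (𝓝[W \ {x}] x) := by
    refine limsup_le_limsup ?_
    filter_upwards [self_mem_nhdsWithin] with z hz
    have hd : 0 < dist x z := dist_pos.2 fun h => hz.2 h.symm
    rw [← ENNReal.ofReal_mul h0.le, ← ENNReal.ofReal_add (by positivity) (by positivity),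
      ← ENNReal.ofReal_add (by positivity) (by positivity)]
    refine ENNReal.ofReal_le_ofReal ?_
    rw [div_le_iff₀ hd, add_mul, add_mul, div_mul_cancel₀ _ hd.ne', div_mul_cancel₀ _ hd.ne',
      ← add_assoc]
    exact abs_glue_sub_glue_le hab x z
  refine step.trans ((ENNReal.limsup_add_le_add_limsup _ _).trans (add_le_add ?_
    ((ENNReal.limsup_add_le_add_limsup _ _).trans (add_le_add ?_ ?_))))
  · exact slopeOn_le_of_eqOn_nhds hx1 h1 EventuallyEq.rfl
  · exact slopeOn_le_of_eqOn_nhds hx2 h2 EventuallyEq.rfl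
  · exact limsup_le_of_le (h := Eventually.of_forall fun _ => le_rfl)

theorem LocLipOn.congr_nhds {W Ω : Set X} {x : X} {h : X → ℝ} (hΩ : IsOpen Ω)
    (hf : LocLipOn Ω f) (hx : x ∈ Ω) (hfh : h =ᶠ[𝓝 x] f) :
    ∃ r > (0 : ℝ), ∃ K : NNReal, LipschitzOnWith K h (ball x r ∩ W) := by
  obtain ⟨r, hr, K, hK⟩ := hf x hx
  obtain ⟨s, hs, hsub⟩ := Metric.mem_nhds_iff.1 (inter_mem hfh (hΩ.mem_nhds hx))
  refine ⟨min r s, lt_min hr hs, K, fun p hp q hq => ?_⟩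
  have hp' := hsub (ball_subset_ball (min_le_right r s) hp.1)
  have hq' := hsub (ball_subset_ball (min_le_right r s) hq.1)
  rw [show h p = f p from hp'.1, show h q = f q from hq'.1]
  exact hK ⟨ball_subset_ball (min_le_left r s) hp.1, hp'.2⟩
    ⟨ball_subset_ball (min_le_left r s) hq.1, hq'.2⟩

theorem LocLipOn.glue {W Ω₁ Ω₂ : Set X} (hab : a < b) (h1 : IsOpen Ω₁) (h2 : IsOpen Ω₂)
    (hf : LocLipOn Ω₁ f) (hg : LocLipOn Ω₂ g) (hW1 : W ∩ {z | dist z y ≤ b} ⊆ Ω₁)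
    (hW2 : W ∩ {z | a ≤ dist z y} ⊆ Ω₂) : LocLipOn W (glue y a b f g) := by
  intro x hx
  rcases lt_or_ge (dist x y) a with hxa | hxa
  · exact hf.congr_nhds h1 (hW1 ⟨hx, (hxa.trans hab).le⟩) (glue_eventuallyEq_left hab hxa)
  rcases lt_or_ge b (dist x y) with hxb | hxb
  · exact hg.congr_nhds h2 (hW2 ⟨hx, hxa⟩) (glue_eventuallyEq_right hab hxb)
  have hx1 : x ∈ Ω₁ := hW1 ⟨hx, hxb⟩
  have hx2 : x ∈ Ω₂ := hW2 ⟨hx, hxa⟩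
  have hL : 0 < 1 / (b - a) := one_div_pos.2 (sub_pos.2 hab)
  obtain ⟨r, hr, K, hK⟩ := hf x hx1
  obtain ⟨s, hs, M, hM⟩ := hg x hx2
  have hcont : ContinuousAt (fun z => |f z - g z|) x :=
    ((hf.continuousOn.continuousAt (h1.mem_nhds hx1)).sub
      (hg.continuousOn.continuousAt (h2.mem_nhds hx2))).abs
  have hbdd : ∀ᶠ z in 𝓝 x, |f z - g z| < |f x - g x| + 1 :=
    hcont.eventually (gt_mem_nhds (lt_add_one _))
  obtain ⟨t, ht, hsub⟩ := Metric.mem_nhds_iff.1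
    (inter_mem hbdd (inter_mem (inter_mem (h1.mem_nhds hx1) (h2.mem_nhds hx2))
      (inter_mem (ball_mem_nhds x hr) (ball_mem_nhds x hs))))
  refine ⟨t, ht, K + M + Real.toNNReal (1 / (b - a) * (|f x - g x| + 1)),
    LipschitzOnWith.of_dist_le_mul fun p hp q hq => ?_⟩
  obtain ⟨hp0, ⟨hp1, hp2⟩, hp3, hp4⟩ := hsub hp.1
  obtain ⟨hq0, ⟨hq1, hq2⟩, hq3, hq4⟩ := hsub hq.1
  have e1 := hK.dist_le_mul p ⟨hp3, hp1⟩ q ⟨hq3, hq1⟩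
  have e2 := hM.dist_le_mul p ⟨hp4, hp2⟩ q ⟨hq4, hq2⟩
  rw [Real.dist_eq] at e1 e2 ⊢
  have hp0' : |f p - g p| ≤ |f x - g x| + 1 := le_of_lt hp0
  refine (abs_glue_sub_glue_le hab p q).trans ?_
  rw [NNReal.coe_add, NNReal.coe_add, Real.coe_toNNReal _ (by positivity), add_mul, add_mul]
  gcongr

theorem abs_glue_sub_le (u : X → ℝ) (z : X) :
    |glue y a b f g z - u z| ≤ cutoff y a b z * |f z - u z|
      + (1 - cutoff y a b z) * |g z - u z| := by
  have e : glue y a b f g z - u z =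
      cutoff y a b z * (f z - u z) + (1 - cutoff y a b z) * (g z - u z) := by
    simp only [glue]; ring
  rw [e]
  refine (abs_add_le _ _).trans_eq ?_
  rw [abs_mul, abs_mul, abs_of_nonneg (cutoff_nonneg z),
    abs_of_nonneg (sub_nonneg.2 (cutoff_le_one z))]

end Glue

section TotVar

variable [MetricSpace X] [MeasurableSpace X] {m : Measure X}

theorem totVar_mono {u : X → ℝ} {A B : Set X} (h : A ⊆ B) : totVar m u A ≤ totVar m u B :=
  iInf_mono fun _ => iInf_mono fun _ => iInf_mono' fun hB => ⟨h.trans hB, le_rfl⟩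

theorem exists_locLipOn_of_totVar_lt {u : X → ℝ} {Ω K : Set X} {c ε : ℝ≥0∞}
    (hc : totVar m u Ω < c) (hK : IsCompact K) (hKΩ : K ⊆ Ω) (hε : ε ≠ 0) :
    ∃ f : X → ℝ, LocLipOn Ω f ∧ ∫⁻ x in K, ENNReal.ofReal |f x - u x| ∂m ≤ ε ∧
      ∫⁻ x in Ω, slopeOn Ω f x ∂m ≤ c := by
  simp only [totVar, iInf_lt_iff] at hc
  obtain ⟨Ω', hΩ', hsub, fn, hfn, hlim, hlt⟩ := hc
  have h1 := frequently_lt_of_liminf_lt (h := hlt)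
  have h2 : ∀ᶠ n in atTop, ∫⁻ x in K, ENNReal.ofReal |fn n x - u x| ∂m < ε :=
    (hlim K (hKΩ.trans hsub) hK).eventually (gt_mem_nhds (pos_iff_ne_zero.2 hε))
  obtain ⟨n, hn1, hn2⟩ := (h1.and_eventually h2).exists
  refine ⟨fn n, (hfn n).mono hsub, hn2.le, le_trans ?_ hn1.le⟩
  exact (lintegral_mono fun x => slopeOn_mono hsub _ x).trans (lintegral_mono_set hsub)

theorem exists_le_lintegral_slopeOn_of_lt_totVar [ProperSpace X] {u : X → ℝ} {Ω : Set X}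
    {c : ℝ≥0∞} (hΩ : IsOpen Ω) (hc : c < totVar m u Ω) :
    ∃ K ⊆ Ω, IsCompact K ∧ ∃ ε : ℝ≥0∞, ε ≠ 0 ∧ ∀ f : X → ℝ, LocLipOn Ω f →
      ∫⁻ x in K, ENNReal.ofReal |f x - u x| ∂m ≤ ε → c ≤ ∫⁻ x in Ω, slopeOn Ω f x ∂m := by
  by_contra! hcon
  have : LocallyCompactSpace Ω := hΩ.locallyCompactSpace
  let Kx : CompactExhaustion Ω := CompactExhaustion.choice Ω
  have hsub (n : ℕ) : ((↑) '' Kx n : Set X) ⊆ Ω := by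
    rintro _ ⟨z, -, rfl⟩; exact z.2
  have hcpt (n : ℕ) : IsCompact ((↑) '' Kx n : Set X) :=
    (Kx.isCompact n).image continuous_subtype_val
  choose fn hfn hL1 hE using fun n : ℕ => hcon _ (hsub n) (hcpt n) ((n : ℝ≥0∞)⁻¹)
    (by simp)
  have hlim : TendstoL1loc m Ω fn u := by
    intro K hKΩ hK
    have hK' : IsCompact ((↑) ⁻¹' K : Set Ω) := by
      rw [Subtype.isCompact_iff, Subtype.image_preimage_coe, inter_eq_right.2 hKΩ]
      exact hK
    obtain ⟨N, hN⟩ := Kx.exists_superset_of_isCompact hK'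
    refine tendsto_of_tendsto_of_tendsto_of_le_of_le' tendsto_const_nhds
      ENNReal.tendsto_inv_nat_nhds_zero (Eventually.of_forall fun _ => zero_le) ?_
    filter_upwards [eventually_ge_atTop N] with n hn
    refine (lintegral_mono_set ?_).trans (hL1 n)
    intro z hz
    exact ⟨⟨z, hKΩ hz⟩, Kx.subset hn (hN hz), rfl⟩
  refine hc.not_ge ?_
  unfold totVar
  refine (iInf₂_le_of_le Ω hΩ (iInf_le_of_le Subset.rfl (iInf₂_le_of_le fn hfn
    (iInf_le _ hlim)))).trans ?_
  refine liminf_le_of_le (h := fun d hd => ?_)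
  obtain ⟨n, hn⟩ := hd.exists
  exact hn.trans (hE n).le

theorem exists_totVar_le_lintegral_slopeOn_add [ProperSpace X] {u : X → ℝ} {Ω : Set X}
    {η : ℝ≥0∞} (hΩ : IsOpen Ω) (hfin : totVar m u Ω ≠ ∞) (hη : η ≠ 0) :
    ∃ K ⊆ Ω, IsCompact K ∧ ∃ ε : ℝ≥0∞, ε ≠ 0 ∧ ∀ f : X → ℝ, LocLipOn Ω f →
      ∫⁻ x in K, ENNReal.ofReal |f x - u x| ∂m ≤ ε →
        totVar m u Ω ≤ ∫⁻ x in Ω, slopeOn Ω f x ∂m + η := by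
  rcases eq_or_ne (totVar m u Ω) 0 with h0 | h0
  · exact ⟨∅, empty_subset _, isCompact_empty, 1, one_ne_zero, fun f _ _ => by simp [h0]⟩
  obtain ⟨K, hK, hKc, ε, hε, h⟩ :=
    exists_le_lintegral_slopeOn_of_lt_totVar hΩ (ENNReal.sub_lt_self hfin h0 hη)
  exact ⟨K, hK, hKc, ε, hε, fun f hf hfe => tsub_le_iff_right.1 (h f hf hfe)⟩

theorem DeformIneq.mono {E : Set X} {x : X} {R C C' : ℝ} (h : DeformIneq m E x R C)
    (hC : C ≤ C') : DeformIneq m E x R C' := by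
  intro y hy r hr
  obtain ⟨h1, h2⟩ := h y hy r hr
  exact ⟨h1.trans (by gcongr), h2.trans (by gcongr)⟩

end TotVar

section Energy

variable [MetricSpace X] [MeasurableSpace X] [BorelSpace X] {m : Measure X}

theorem aemeasurable_slopeOn {Ω S : Set X} (hΩ : IsOpen Ω) (hSΩ : S ⊆ Ω) {f : X → ℝ}
    (hf : ContinuousOn f Ω) : AEMeasurable (slopeOn Ω f) (m.restrict S) :=
  ((aemeasurable_indicator_iff hΩ.measurableSet).1
    (measurable_indicator_slopeOn hΩ hf).aemeasurable).mono_measure (Measure.restrict_mono hSΩ le_rfl)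

theorem aemeasurable_ofReal_abs_sub {Ω S : Set X} (hΩ : IsOpen Ω) (hSΩ : S ⊆ Ω)
    {f u : X → ℝ} (hf : ContinuousOn f Ω) (hu : Measurable u) :
    AEMeasurable (fun x => ENNReal.ofReal |f x - u x|) (m.restrict S) :=
  (measurable_abs.comp_aemeasurable (((hf.aemeasurable hΩ.measurableSet).mono_measure
    (Measure.restrict_mono hSΩ le_rfl)).sub hu.aemeasurable)).ennreal_ofReal

theorem lintegral_abs_sub_le_add {Ω S : Set X} (hΩ : IsOpen Ω) (hSΩ : S ⊆ Ω)
    (hS : MeasurableSet S) {f g u v : X → ℝ} (hf : ContinuousOn f Ω) (hu : Measurable u)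
    (huv : EqOn u v S) :
    ∫⁻ x in S, ENNReal.ofReal |f x - g x| ∂m ≤
      ∫⁻ x in S, ENNReal.ofReal |f x - u x| ∂m + ∫⁻ x in S, ENNReal.ofReal |g x - v x| ∂m := by
  rw [← lintegral_add_left' (aemeasurable_ofReal_abs_sub hΩ hSΩ hf hu)]
  refine setLIntegral_mono' hS fun x hx => ?_
  rw [← ENNReal.ofReal_add (abs_nonneg _) (abs_nonneg _), ← huv hx, abs_sub_comm (g x)]
  exact ENNReal.ofReal_le_ofReal (abs_sub_le _ _ _)

variable {y : X} {a b : ℝ} {f g : X → ℝ} {W Ω₁ Ω₂ : Set X}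

theorem measurableSet_dist_le (y : X) (b : ℝ) : MeasurableSet {z : X | dist z y ≤ b} :=
  isClosed_closedBall.measurableSet

theorem measurableSet_le_dist (y : X) (a : ℝ) : MeasurableSet {z : X | a ≤ dist z y} :=
  (isClosed_le continuous_const (by fun_prop)).measurableSet

theorem lintegral_slopeOn_glue_le (hab : a < b) (hW : IsOpen W) (h1 : IsOpen Ω₁) (h2 : IsOpen Ω₂)
    (hf : LocLipOn Ω₁ f) (hg : LocLipOn Ω₂ g) (hW1 : W ∩ {z | dist z y ≤ b} ⊆ Ω₁)
    (hW2 : W ∩ {z | a ≤ dist z y} ⊆ Ω₂) :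
    ∫⁻ x in W, slopeOn W (glue y a b f g) x ∂m ≤
      ∫⁻ x in Ω₁ ∩ {z | dist z y ≤ b}, slopeOn Ω₁ f x ∂m +
      (∫⁻ x in Ω₂ ∩ {z | a ≤ dist z y}, slopeOn Ω₂ g x ∂m +
        ENNReal.ofReal (1 / (b - a)) *
          ∫⁻ x in W ∩ ({z | dist z y ≤ b} ∩ {z | a ≤ dist z y}),
            ENNReal.ofReal |f x - g x| ∂m) := by
  have hS1 := measurableSet_dist_le y b
  have hS2 := measurableSet_le_dist y a
  have hO1 := h1.measurableSet.inter hS1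
  have hO2 := h2.measurableSet.inter hS2
  have hT := hW.measurableSet.inter (hS1.inter hS2)
  rw [← lintegral_const_mul' _ _ ENNReal.ofReal_ne_top, ← lintegral_indicator hW.measurableSet,
    ← lintegral_indicator hO1, ← lintegral_indicator hO2, ← lintegral_indicator hT,
    ← lintegral_add_left' ((aemeasurable_indicator_iff hO2).2
      (aemeasurable_slopeOn h2 inter_subset_left hg.continuousOn)),
    ← lintegral_add_left' ((aemeasurable_indicator_iff hO1).2
      (aemeasurable_slopeOn h1 inter_subset_left hf.continuousOn))]
  refine lintegral_mono fun x => ?_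
  by_cases hx : x ∈ W
  swap
  · rw [indicator_of_notMem hx]; exact zero_le
  rw [indicator_of_mem hx]
  rcases lt_or_ge (dist x y) a with hxa | hxa
  · have hx1 : x ∈ Ω₁ := hW1 ⟨hx, (hxa.trans hab).le⟩
    refine le_add_right ?_
    rw [indicator_of_mem (show x ∈ Ω₁ ∩ {z | dist z y ≤ b} from ⟨hx1, (hxa.trans hab).le⟩)]
    exact slopeOn_le_of_eqOn_nhds hx1 h1 (glue_eventuallyEq_left hab hxa)
  have hx2 : x ∈ Ω₂ := hW2 ⟨hx, hxa⟩
  rw [indicator_of_mem (show x ∈ Ω₂ ∩ {z | a ≤ dist z y} from ⟨hx2, hxa⟩)]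
  rcases lt_or_ge b (dist x y) with hxb | hxb
  · refine le_add_left (le_add_right ?_)
    exact slopeOn_le_of_eqOn_nhds hx2 h2 (glue_eventuallyEq_right hab hxb)
  have hx1 : x ∈ Ω₁ := hW1 ⟨hx, hxb⟩
  rw [indicator_of_mem (show x ∈ Ω₁ ∩ {z | dist z y ≤ b} from ⟨hx1, hxb⟩),
    indicator_of_mem (show x ∈ W ∩ ({z | dist z y ≤ b} ∩ {z | a ≤ dist z y}) from
      ⟨hx, hxb, hxa⟩)]
  exact slopeOn_glue_le hab h1 h2 hx1 hx2

theorem lintegral_abs_glue_sub_le {K : Set X} {u : X → ℝ} (hab : a < b) (hK : MeasurableSet K)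
    (h1 : IsOpen Ω₁) (hf : LocLipOn Ω₁ f) (hK1 : K ∩ {z | dist z y ≤ b} ⊆ Ω₁)
    (hu : Measurable u) :
    ∫⁻ x in K, ENNReal.ofReal |glue y a b f g x - u x| ∂m ≤
      ∫⁻ x in K ∩ {z | dist z y ≤ b}, ENNReal.ofReal |f x - u x| ∂m +
      ∫⁻ x in K ∩ {z | a ≤ dist z y}, ENNReal.ofReal |g x - u x| ∂m := by
  have hO1 := hK.inter (measurableSet_dist_le y b)
  have hO2 := hK.inter (measurableSet_le_dist y a)
  rw [← lintegral_indicator hK, ← lintegral_indicator hO1, ← lintegral_indicator hO2,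
    ← lintegral_add_left' ((aemeasurable_indicator_iff hO1).2
      (aemeasurable_ofReal_abs_sub h1 hK1 hf.continuousOn hu))]
  refine lintegral_mono fun x => ?_
  by_cases hx : x ∈ K
  swap
  · rw [indicator_of_notMem hx]; exact zero_le
  rw [indicator_of_mem hx]
  rcases lt_or_ge (dist x y) a with hxa | hxa
  · refine le_add_right ?_
    rw [indicator_of_mem (show x ∈ K ∩ {z | dist z y ≤ b} from ⟨hx, (hxa.trans hab).le⟩),
      glue_eq_left hab hxa.le]
  rw [indicator_of_mem (show x ∈ K ∩ {z | a ≤ dist z y} from ⟨hx, hxa⟩)]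
  rcases lt_or_ge b (dist x y) with hxb | hxb
  · refine le_add_left ?_
    rw [glue_eq_right hab hxb.le]
  rw [indicator_of_mem (show x ∈ K ∩ {z | dist z y ≤ b} from ⟨hx, hxb⟩),
    ← ENNReal.ofReal_add (abs_nonneg _) (abs_nonneg _)]
  refine ENNReal.ofReal_le_ofReal ((abs_glue_sub_le u x).trans (add_le_add ?_ ?_))
  · exact mul_le_of_le_one_left (abs_nonneg _) (cutoff_le_one x)
  · exact mul_le_of_le_one_left (abs_nonneg _)
      (by linarith [cutoff_nonneg (y := y) (a := a) (b := b) x])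

end Energy

section Localization

variable [MetricSpace X] [MeasurableSpace X] [BorelSpace X] {m : Measure X}

theorem setLIntegral_dist_le_add_setLIntegral_le_dist {Ω : Set X} (hΩ : MeasurableSet Ω) {y : X}
    {a b : ℝ} (hab : a < b) (φ : X → ℝ≥0∞) :
    ∫⁻ x in Ω ∩ {z | dist z y ≤ b}, φ x ∂m + ∫⁻ x in Ω ∩ {z | a ≤ dist z y}, φ x ∂m =
      ∫⁻ x in Ω, φ x ∂m + ∫⁻ x in Ω ∩ ({z | dist z y ≤ b} ∩ {z | a ≤ dist z y}), φ x ∂m := by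
  have hS1 := measurableSet_dist_le y b
  have hS2 := measurableSet_le_dist y a
  have hun : Ω ∩ {z | dist z y ≤ b} ∪ Ω ∩ {z | a ≤ dist z y} = Ω := by
    rw [← inter_union_distrib_left, inter_eq_left]
    intro z _
    rcases le_total (dist z y) b with h | h
    · exact Or.inl h
    · exact Or.inr (hab.le.trans h)
  have := measure_union_add_inter (μ := m.withDensity φ) (Ω ∩ {z | dist z y ≤ b}) (hΩ.inter hS2)
  rw [hun, ← inter_inter_distrib_left, withDensity_apply _ hΩ, withDensity_apply _ (hΩ.inter hS1),
    withDensity_apply _ (hΩ.inter hS2), withDensity_apply _ (hΩ.inter (hS1.inter hS2))] at this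
  exact this.symm

/-- De Giorgi slicing: some annulus among `N` disjoint ones carries at most the average energy. -/
theorem exists_annulus_setLIntegral_le {y : X} {r s : ℝ} (hrs : r < s) {φ ψ : X → ℝ≥0∞}
    {M η : ℝ≥0∞} {N : ℕ} (hN : M < N * η)
    (hM : ∫⁻ x in closedBall y s, φ x ∂m + ∫⁻ x in closedBall y s, ψ x ∂m ≤ M) :
    ∃ a b : ℝ, r ≤ a ∧ b ≤ s ∧ b - a = (s - r) / (2 * N) ∧
      ∫⁻ x in {z | dist z y ≤ b} ∩ {z | a ≤ dist z y}, φ x ∂m +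
        ∫⁻ x in {z | dist z y ≤ b} ∩ {z | a ≤ dist z y}, ψ x ∂m ≤ η := by
  have hN0 : (0 : ℝ) < N := by
    rcases Nat.eq_zero_or_pos N with h | h
    · simp [h] at hN
    · exact_mod_cast h
  have hδ : 0 < (s - r) / (2 * N) := div_pos (sub_pos.2 hrs) (by positivity)
  have hδN : 2 * N * ((s - r) / (2 * N)) = s - r := by field_simp
  set δ := (s - r) / (2 * N) with hδdef
  set T : ℕ → Set X := fun i =>
    {z | dist z y ≤ r + (2 * i + 1) * δ} ∩ {z | r + 2 * i * δ ≤ dist z y} with hT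
  have hTs : ∀ i ∈ Finset.range N, T i ⊆ closedBall y s := by
    intro i hi z hz
    have hi' : (i : ℝ) + 1 ≤ N := by exact_mod_cast Finset.mem_range.1 hi
    have hz' : dist z y ≤ r + (2 * i + 1) * δ := hz.1
    rw [mem_closedBall]
    nlinarith
  have hTm : ∀ i ∈ Finset.range N, MeasurableSet (T i) := fun i _ =>
    (measurableSet_dist_le _ _).inter (measurableSet_le_dist _ _)
  have hlt : ∀ i j : ℕ, i < j → Disjoint (T i) (T j) := by
    intro i j hij
    refine Set.disjoint_left.2 fun z hi hj => ?_
    have h1 : dist z y ≤ r + (2 * i + 1) * δ := hi.1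
    have h2 : r + 2 * j * δ ≤ dist z y := hj.2
    have h3 : (i : ℝ) + 1 ≤ j := by exact_mod_cast hij
    nlinarith
  have hTd : ((Finset.range N : Finset ℕ) : Set ℕ).PairwiseDisjoint T := by
    intro i _ j _ hij
    rcases lt_or_gt_of_ne hij with h | h
    · exact hlt i j h
    · exact (hlt j i h).symm
  have hsum : ∑ i ∈ Finset.range N, (∫⁻ x in T i, φ x ∂m + ∫⁻ x in T i, ψ x ∂m) ≤ M := by
    rw [Finset.sum_add_distrib, ← lintegral_biUnion_finset hTd hTm, ← lintegral_biUnion_finset hTd hTm]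
    exact (add_le_add (lintegral_mono_set (iUnion₂_subset hTs))
      (lintegral_mono_set (iUnion₂_subset hTs))).trans hM
  obtain ⟨i, hi, hle⟩ : ∃ i ∈ Finset.range N,
      ∫⁻ x in T i, φ x ∂m + ∫⁻ x in T i, ψ x ∂m ≤ η := by
    by_contra! hcon
    have := Finset.card_nsmul_le_sum (Finset.range N) _ η fun i hi => (hcon i hi).le
    rw [Finset.card_range, nsmul_eq_mul] at this
    exact absurd (this.trans hsum) hN.not_ge
  have hi' : (i : ℝ) + 1 ≤ N := by exact_mod_cast Finset.mem_range.1 hi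
  refine ⟨r + 2 * i * δ, r + (2 * i + 1) * δ, ?_, ?_, by ring, hle⟩
  · have : 0 ≤ 2 * (i : ℝ) * δ := by positivity
    linarith
  · nlinarith

theorem totVar_le_add_totVar_of_subset [ProperSpace X] {u v : X → ℝ} (hu : Measurable u)
    (hv : Measurable v) {A U : Set X} (hA : IsOpen A) (hU : IsOpen U) (hUA : U ⊆ A) {y : X}
    {r s : ℝ} (hrs : r < s) (hsU : closedBall y s ⊆ U) (huv : ∀ z, r ≤ dist z y → u z = v z)
    {q : ℝ≥0∞} (hfin : totVar m u A ≠ ∞) (hle : totVar m v A ≤ q + totVar m u A) :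
    totVar m v U ≤ q + totVar m u U := by
  rcases eq_or_ne q ∞ with rfl | hq
  · simp
  refine le_of_forall_lt_imp_le_of_dense fun c hc => ENNReal.le_of_forall_pos_le_add
    fun ε hε _ => ?_
  obtain ⟨η, hη0, hηtop, hηε⟩ : ∃ η : ℝ≥0∞, η ≠ 0 ∧ η ≠ ∞ ∧ 6 * η = ε :=
    ⟨ε / 6, by simp [hε.ne'], (ENNReal.div_lt_top ENNReal.coe_ne_top (by norm_num)).ne,
      ENNReal.mul_div_cancel (by norm_num) (by norm_num)⟩
  have hvA : totVar m v A ≠ ∞ := (hle.trans_lt (ENNReal.add_lt_top.2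
    ⟨hq.lt_top, hfin.lt_top⟩)).ne
  have huU : totVar m u U ≠ ∞ := ((totVar_mono hUA).trans_lt hfin.lt_top).ne
  set M := (totVar m v A + η) + (totVar m u U + η) with hMdef
  have hM : M ≠ ∞ := by simp [hMdef, hvA, huU, hηtop]
  obtain ⟨N, hN⟩ := ENNReal.exists_nat_mul_gt hη0 hM
  have hN0 : (0 : ℝ) < N := by
    rcases Nat.eq_zero_or_pos N with h | h
    · simp [h] at hN
    · exact_mod_cast h
  set L := ENNReal.ofReal (1 / ((s - r) / (2 * N))) with hL
  obtain ⟨K₁, hK₁U, hK₁, ε₁, hε₁, hlow₁⟩ := exists_le_lintegral_slopeOn_of_lt_totVar hU hc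
  obtain ⟨K₂, hK₂A, hK₂, ε₂, hε₂, hlow₂⟩ := exists_totVar_le_lintegral_slopeOn_add hA hfin hη0
  obtain ⟨e, he0, he₁, he₂, heL⟩ : ∃ e : ℝ≥0∞, e ≠ 0 ∧ e + e ≤ ε₁ ∧ e + e ≤ ε₂ ∧
      L * (e + e) ≤ η := by
    refine ⟨min (min ε₁ ε₂) (η / L) / 2, ?_, ?_, ?_, ?_⟩
    · have : η / L ≠ 0 := ENNReal.div_ne_zero.2 ⟨hη0, ENNReal.ofReal_ne_top⟩
      exact (ENNReal.half_pos (lt_min (lt_min (pos_iff_ne_zero.2 hε₁) (pos_iff_ne_zero.2 hε₂))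
        (pos_iff_ne_zero.2 this)).ne').ne'
    · rw [ENNReal.add_halves]; exact (min_le_left _ _).trans (min_le_left _ _)
    · rw [ENNReal.add_halves]; exact (min_le_left _ _).trans (min_le_right _ _)
    · rw [ENNReal.add_halves]
      exact (mul_le_mul_right (min_le_right _ _) _).trans ENNReal.mul_div_le
  have hball : IsCompact (closedBall y s) := isCompact_closedBall y s
  obtain ⟨f, hf, hfK, hfE⟩ := exists_locLipOn_of_totVar_lt
    (ENNReal.lt_add_right hvA hη0) ((hK₁.union hK₂).union hball)
    (union_subset (union_subset (hK₁U.trans hUA) hK₂A) (hsU.trans hUA)) he0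
  obtain ⟨g, hg, hgK, hgE⟩ := exists_locLipOn_of_totVar_lt
    (ENNReal.lt_add_right huU hη0) (hK₁.union hball) (union_subset hK₁U hsU) he0
  obtain ⟨a, b, hra, hbs, hba, hsmall⟩ := exists_annulus_setLIntegral_le (m := m) (y := y) hrs
    (φ := slopeOn A f) (ψ := slopeOn U g) hN
    (add_le_add ((lintegral_mono_set (hsU.trans hUA)).trans hfE)
      ((lintegral_mono_set hsU).trans hgE))
  have hab : a < b := by
    have : 0 < (s - r) / (2 * N) := div_pos (sub_pos.2 hrs) (by positivity)
    linarith
  have hS1 : {z | dist z y ≤ b} ⊆ closedBall y s := fun z hz => le_trans hz hbs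
  have hS2 : EqOn u v {z | a ≤ dist z y} := fun z hz => huv z (hra.trans hz)
  have hmS1 := measurableSet_dist_le y b
  have hmS2 := measurableSet_le_dist y a
  have hfs {S : Set X} (hS : S ⊆ K₁ ∪ K₂ ∪ closedBall y s) :
      ∫⁻ x in S, ENNReal.ofReal |f x - v x| ∂m ≤ e := (lintegral_mono_set hS).trans hfK
  have hgs {S : Set X} (hS : S ⊆ K₁ ∪ closedBall y s) :
      ∫⁻ x in S, ENNReal.ofReal |g x - u x| ∂m ≤ e := (lintegral_mono_set hS).trans hgK
  have hlow₁' := hlow₁ (glue y a b f g)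
    (hf.glue hab hA hU hg (inter_subset_left.trans hUA) inter_subset_left) (by
      refine (lintegral_abs_glue_sub_le hab hK₁.measurableSet hA hf
        (inter_subset_left.trans (hK₁U.trans hUA)) hv).trans (le_trans (add_le_add
          (hfs (inter_subset_left.trans (subset_union_left.trans subset_union_left))) ?_) he₁)
      rw [setLIntegral_congr_fun (g := fun x => ENNReal.ofReal |g x - u x|)
        (hK₁.measurableSet.inter hmS2) fun x hx => by simp only [hS2 hx.2]]
      exact hgs (inter_subset_left.trans subset_union_left))
  have hlow₂' := hlow₂ (glue y a b g f)
    (hg.glue hab hU hA hf (inter_subset_right.trans (hS1.trans hsU)) inter_subset_left) (by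
      refine (lintegral_abs_glue_sub_le hab hK₂.measurableSet hU hg
        (inter_subset_right.trans (hS1.trans hsU)) hu).trans (le_trans (add_le_add
          (hgs (inter_subset_right.trans (hS1.trans subset_union_right))) ?_) he₂)
      rw [setLIntegral_congr_fun (g := fun x => ENNReal.ofReal |f x - v x|)
        (hK₂.measurableSet.inter hmS2) fun x hx => by simp only [hS2 hx.2]]
      exact hfs (inter_subset_left.trans (subset_union_right.trans subset_union_left)))
  have hE₁ := lintegral_slopeOn_glue_le (m := m) (y := y) hab hU hA hU hf hg
    (inter_subset_left.trans hUA) inter_subset_left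
  have hE₂ := lintegral_slopeOn_glue_le (m := m) (y := y) hab hA hU hA hg hf
    (inter_subset_right.trans (hS1.trans hsU)) inter_subset_left
  rw [hba] at hE₁ hE₂
  have hT : {z | dist z y ≤ b} ∩ {z | a ≤ dist z y} ⊆ closedBall y s :=
    inter_subset_left.trans hS1
  have hI₁ : ∫⁻ x in U ∩ ({z | dist z y ≤ b} ∩ {z | a ≤ dist z y}),
      ENNReal.ofReal |f x - g x| ∂m ≤ e + e :=
    (lintegral_abs_sub_le_add hA (inter_subset_left.trans hUA)
      (hU.measurableSet.inter (hmS1.inter hmS2)) hf.continuousOn hv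
      fun x hx => (hS2 hx.2.2).symm).trans (add_le_add
        (hfs (inter_subset_right.trans (hT.trans subset_union_right)))
        (hgs (inter_subset_right.trans (hT.trans subset_union_right))))
  have hI₂ : ∫⁻ x in A ∩ ({z | dist z y ≤ b} ∩ {z | a ≤ dist z y}),
      ENNReal.ofReal |g x - f x| ∂m ≤ e + e :=
    (lintegral_abs_sub_le_add hU (inter_subset_right.trans (hT.trans hsU))
      (hA.measurableSet.inter (hmS1.inter hmS2)) hg.continuousOn hu
      fun x hx => hS2 hx.2.2).trans (add_le_add
        (hgs (inter_subset_right.trans (hT.trans subset_union_right)))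
        (hfs (inter_subset_right.trans (hT.trans subset_union_right))))
  have hJ₁ := (mul_le_mul_right hI₁ L).trans heL
  have hJ₂ := (mul_le_mul_right hI₂ L).trans heL
  have hsf := setLIntegral_dist_le_add_setLIntegral_le_dist (m := m) (y := y) hA.measurableSet hab
    (slopeOn A f)
  have hsg := setLIntegral_dist_le_add_setLIntegral_le_dist (m := m) (y := y) hU.measurableSet hab
    (slopeOn U g)
  have hTf := lintegral_mono_set (μ := m) (f := slopeOn A f)
    (inter_subset_right : A ∩ ({z | dist z y ≤ b} ∩ {z | a ≤ dist z y}) ⊆ _)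
  have hTg := lintegral_mono_set (μ := m) (f := slopeOn U g)
    (inter_subset_right : U ∩ ({z | dist z y ≤ b} ∩ {z | a ≤ dist z y}) ⊆ _)
  refine (ENNReal.add_le_add_iff_right hfin).1 ?_
  calc c + totVar m u A
      ≤ _ := add_le_add (hlow₁'.trans (hE₁.trans (add_le_add le_rfl (add_le_add le_rfl hJ₁))))
        (hlow₂'.trans (add_le_add (hE₂.trans (add_le_add le_rfl (add_le_add le_rfl hJ₂))) le_rfl))
    _ = (∫⁻ x in A ∩ {z | dist z y ≤ b}, slopeOn A f x ∂m
          + ∫⁻ x in A ∩ {z | a ≤ dist z y}, slopeOn A f x ∂m)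
        + (∫⁻ x in U ∩ {z | dist z y ≤ b}, slopeOn U g x ∂m
          + ∫⁻ x in U ∩ {z | a ≤ dist z y}, slopeOn U g x ∂m) + 3 * η := by ring
    _ ≤ ((totVar m v A + η) + ∫⁻ x in {z | dist z y ≤ b} ∩ {z | a ≤ dist z y}, slopeOn A f x ∂m)
        + ((totVar m u U + η)
          + ∫⁻ x in {z | dist z y ≤ b} ∩ {z | a ≤ dist z y}, slopeOn U g x ∂m) + 3 * η := by
      rw [hsf, hsg]
      exact add_le_add (add_le_add (add_le_add hfE hTf) (add_le_add hgE hTg)) le_rfl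
    _ = totVar m v A + totVar m u U
        + (∫⁻ x in {z | dist z y ≤ b} ∩ {z | a ≤ dist z y}, slopeOn A f x ∂m
          + ∫⁻ x in {z | dist z y ≤ b} ∩ {z | a ≤ dist z y}, slopeOn U g x ∂m) + 5 * η := by ring
    _ ≤ (q + totVar m u A) + totVar m u U + η + 5 * η := by gcongr
    _ = q + totVar m u U + 6 * η + totVar m u A := by ring
    _ = _ := by rw [hηε]

theorem exists_isOpen_union_closedBall_totVar_lt_top [ProperSpace X] {u : X → ℝ}
    (hu : Measurable u) {W C : Set X} (hW : IsOpen W) (hWfin : totVar m u W < ∞)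
    (hC : IsCompact C) (hCW : C ⊆ W) {x : X} {ρ : ℝ} (hρ : 0 < ρ)
    (hfin : totVar m u (ball x ρ) < ∞) :
    ∃ W', IsOpen W' ∧ C ∪ closedBall x (ρ / 2) ⊆ W' ∧ totVar m u W' < ∞ := by
  obtain ⟨V, hV, hCV, hVW, hVc⟩ := exists_open_between_and_isCompact_closure hC hW hCW
  have hab : 3 / 4 * ρ < 7 / 8 * ρ := by linarith
  generalize ha : 3 / 4 * ρ = a at hab
  generalize hb : 7 / 8 * ρ = b at hab
  have hW' : IsOpen (ball x a ∪ V) := isOpen_ball.union hV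
  refine ⟨ball x a ∪ V, hW', union_subset (hCV.trans subset_union_right)
    ((closedBall_subset_ball (by linarith)).trans subset_union_left), lt_top_iff_ne_top.2 ?_⟩
  intro htop
  set L := ENNReal.ofReal (1 / (b - a)) with hL
  set c := (totVar m u (ball x ρ) + 1) + ((totVar m u W + 1) + L * (1 + 1)) with hc
  have hcfin : c ≠ ∞ := by
    simp [hc, hfin.ne, hWfin.ne, ENNReal.mul_eq_top, hL]
  obtain ⟨K, hKW, hK, ε, hε, hlow⟩ := exists_le_lintegral_slopeOn_of_lt_totVar (m := m) (u := u)
    (c := c + 1) hW' (by rw [htop]; exact ENNReal.add_lt_top.2 ⟨hcfin.lt_top, one_lt_top⟩)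
  obtain ⟨e, he0, heε, he1⟩ : ∃ e : ℝ≥0∞, e ≠ 0 ∧ e + e ≤ ε ∧ e ≤ 1 := by
    refine ⟨min (ε / 2) 1, ?_, ?_, min_le_right _ _⟩
    · exact (lt_min (ENNReal.half_pos hε) one_pos).ne'
    · exact (add_le_add (min_le_left _ _) (min_le_left _ _)).trans_eq (ENNReal.add_halves ε)
  have hS1 : {z | dist z x ≤ b} ⊆ ball x ρ := fun z (hz : dist z x ≤ b) => by
    rw [mem_ball]; linarith
  have hS2 : (ball x a ∪ V) ∩ {z | a ≤ dist z x} ⊆ closure V := by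
    rintro z ⟨hz | hz, hz'⟩
    · exact absurd (mem_ball.1 hz) (not_lt.2 hz')
    · exact subset_closure hz
  obtain ⟨f, hf, hfK, hfE⟩ := exists_locLipOn_of_totVar_lt
    (ENNReal.lt_add_right hfin.ne one_ne_zero) (isCompact_closedBall x b) hS1 he0
  obtain ⟨g, hg, hgK, hgE⟩ := exists_locLipOn_of_totVar_lt
    (ENNReal.lt_add_right hWfin.ne one_ne_zero) hVc hVW he0
  have hlow' := hlow (glue x a b f g) (hf.glue hab isOpen_ball hW hg
    (inter_subset_right.trans hS1) (hS2.trans hVW))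
    ((lintegral_abs_glue_sub_le hab hK.measurableSet isOpen_ball hf
      (inter_subset_right.trans hS1) hu).trans (le_trans (add_le_add
        ((lintegral_mono_set inter_subset_right).trans hfK)
        ((lintegral_mono_set ((inter_subset_inter_left _ hKW).trans hS2)).trans hgK)) heε))
  have hE := lintegral_slopeOn_glue_le (m := m) hab hW' isOpen_ball hW hf hg
    (inter_subset_right.trans hS1) (hS2.trans hVW)
  have hT1 : (ball x a ∪ V) ∩ ({z | dist z x ≤ b} ∩ {z | a ≤ dist z x}) ⊆ {z | dist z x ≤ b} :=
    fun z hz => hz.2.1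
  have hT2 : (ball x a ∪ V) ∩ ({z | dist z x ≤ b} ∩ {z | a ≤ dist z x}) ⊆ closure V :=
    fun z hz => hS2 ⟨hz.1, hz.2.2⟩
  have hI : ∫⁻ z in (ball x a ∪ V) ∩ ({z | dist z x ≤ b} ∩ {z | a ≤ dist z x}),
      ENNReal.ofReal |f z - g z| ∂m ≤ 1 + 1 :=
    (lintegral_abs_sub_le_add isOpen_ball (hT1.trans hS1)
      (hW'.measurableSet.inter ((measurableSet_dist_le x b).inter (measurableSet_le_dist x a)))
      hf.continuousOn hu fun z _ => rfl).trans (add_le_add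
        (((lintegral_mono_set hT1).trans hfK).trans he1)
        (((lintegral_mono_set hT2).trans hgK).trans he1))
  have hle : c + 1 ≤ c := hlow'.trans (hE.trans (add_le_add
    ((lintegral_mono_set inter_subset_left).trans hfE) (add_le_add
      ((lintegral_mono_set inter_subset_left).trans hgE) (mul_le_mul_right hI L))))
  exact hle.not_gt (ENNReal.lt_add_right hcfin one_ne_zero)

theorem totVar_lt_top_of_isCompact [ProperSpace X] {u : X → ℝ} (hu : Measurable u)
    (hloc : ∀ x, ∃ r > (0 : ℝ), totVar m u (ball x r) < ∞) {K : Set X} (hK : IsCompact K) :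
    totVar m u K < ∞ := by
  choose ρ hρ hfin using hloc
  have step (t : Finset X) : ∃ W, IsOpen W ∧ ⋃ x ∈ t, closedBall x (ρ x / 2) ⊆ W ∧
      totVar m u W < ∞ := by
    classical
    induction t using Finset.induction_on with
    | empty =>
      refine ⟨∅, isOpen_empty, by simp, lt_of_le_of_lt ?_ one_lt_top⟩
      by_contra! hcon
      obtain ⟨K, hK, -, ε, -, h⟩ :=
        exists_le_lintegral_slopeOn_of_lt_totVar (m := m) (u := u) isOpen_empty hcon
      have := h 0 (fun _ h => h.elim) (by simp [subset_empty_iff.1 hK])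
      simp at this
    | insert x t _ ih =>
      obtain ⟨W, hW, hsub, hWfin⟩ := ih
      obtain ⟨W', hW', hsub', hfin'⟩ := exists_isOpen_union_closedBall_totVar_lt_top hu hW hWfin
        (t.isCompact_biUnion fun x _ => isCompact_closedBall x (ρ x / 2)) hsub (hρ x) (hfin x)
      refine ⟨W', hW', ?_, hfin'⟩
      rwa [Finset.set_biUnion_insert, union_comm]
  obtain ⟨t, -, ht⟩ := hK.elim_nhds_subcover (fun x => closedBall x (ρ x / 2))
    fun x _ => closedBall_mem_nhds x (half_pos (hρ x))
  obtain ⟨W, -, hsub, hW⟩ := step t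
  exact (totVar_mono (ht.trans hsub)).trans_lt hW

end Localization

section Deformation

variable [MetricSpace X] [MeasurableSpace X] [BorelSpace X] [ProperSpace X] {m : Measure X}

theorem HasLocFinPer.per_lt_top_of_isBounded {E B : Set X} (hEm : MeasurableSet E)
    (hE : HasLocFinPer m E) (hB : IsBounded B) : Per m E B < ∞ :=
  (totVar_mono subset_closure).trans_lt (totVar_lt_top_of_isCompact
    (measurable_const.indicator hEm) hE hB.isCompact_closure)

theorem per_le_add_per_of_eq_outside_ball {E F : Set X} (hEm : MeasurableSet E)
    (hFm : MeasurableSet F) (hE : HasLocFinPer m E) {x₀ x y : X} {ρ σ r : ℝ}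
    (hsub : ball x σ ⊆ ball x₀ ρ) (hr : dist y x + r < σ)
    (hEF : ∀ z, r ≤ dist z y → (z ∈ E ↔ z ∈ F)) {q : ℝ≥0∞}
    (hle : Per m F (ball x₀ ρ) ≤ q + Per m E (ball x₀ ρ)) :
    Per m F (ball x σ) ≤ q + Per m E (ball x σ) := by
  obtain ⟨s, hrs, hs⟩ := exists_between (show r < σ - dist y x by linarith)
  refine totVar_le_add_totVar_of_subset (measurable_const.indicator hEm)
    (measurable_const.indicator hFm) isOpen_ball isOpen_ball hsub hrs
    (closedBall_subset_ball' (by linarith)) (fun z hz => ?_)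
    (hE.per_lt_top_of_isBounded hEm isBounded_ball).ne hle
  by_cases h : z ∈ E
  · rw [indicator_of_mem h, indicator_of_mem ((hEF z hz).1 h)]
  · rw [indicator_of_notMem h, indicator_of_notMem (mt (hEF z hz).2 h)]

theorem DeformIneq.of_mem_ball {E : Set X} (hEm : MeasurableSet E) (hE : HasLocFinPer m E)
    {x₀ x : X} {R₀ R C : ℝ} (h : DeformIneq m E x₀ R₀ C) (hx : x ∈ ball x₀ (R₀ / 2))
    (hR : R ≤ R₀ / 2) : DeformIneq m E x R C := by
  intro y hy r hr
  rw [mem_ball] at hx hy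
  have htri := dist_triangle y x x₀
  have hrR : r < R := hr.2
  have hr0 : 0 < r := hr.1
  obtain ⟨h1, h2⟩ := h y (mem_ball.2 (by linarith)) r ⟨hr0, by linarith⟩
  have hsub : ball x (2 * R) ⊆ ball x₀ (2 * R₀) := ball_subset_ball' (by linarith)
  refine ⟨per_le_add_per_of_eq_outside_ball hEm (hEm.diff measurableSet_ball) hE hsub
      (by linarith) (fun z hz => ?_) h1,
    per_le_add_per_of_eq_outside_ball hEm (hEm.union measurableSet_ball) hE hsub
      (by linarith) (fun z hz => ?_) h2⟩
  · simp [hz]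
  · simp [hz]

end Deformation

/-- **Uniform deformation constants on bounded sets** (Equation (2.4) and the discussion
around it): in a proper metric measure space with the deformation property, for any set
of locally finite perimeter `E` and any bounded set `B` the deformation inequalities
hold with constants `R, C` depending only on `B` and `E`, uniformly for `x ∈ B`;
in particular `inf_{x ∈ B} R_x(E) > 0`. -/
theorem uniform_deformation_on_bounded_sets
    {X : Type*} [MetricSpace X] [CompleteSpace X] [TopologicalSpace.SeparableSpace X]
    [ProperSpace X] [MeasurableSpace X] [BorelSpace X] (m : Measure X)
    (hbf : BoundedlyFinite m) (hdef : DeformationProperty m)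
    (E : Set X) (hEm : MeasurableSet E) (hEp : HasLocFinPer m E)
    (B : Set X) (hB : Bornology.IsBounded B) :
    (∃ R : ℝ, 0 < R ∧ R ≤ 1 ∧ ∃ C : ℝ, 0 ≤ C ∧ ∀ x ∈ B, DeformIneq m E x R C) ∧
    ∃ ρ > (0:ℝ), ∀ x ∈ B, ρ ≤ deformRadius m E x := by
  have hloc : ∃ R : ℝ, 0 < R ∧ R ≤ 1 ∧ ∃ C : ℝ, 0 ≤ C ∧
      ∀ R', R' ≤ R → ∀ x ∈ closure B, DeformIneq m E x R' C := by
    refine hB.isCompact_closure.induction_on (p := fun S => ∃ R : ℝ, 0 < R ∧ R ≤ 1 ∧ ∃ C : ℝ,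
      0 ≤ C ∧ ∀ R', R' ≤ R → ∀ x ∈ S, DeformIneq m E x R' C) ?_ ?_ ?_ ?_
    · exact ⟨1, one_pos, le_rfl, 0, le_rfl, fun _ _ x hx => hx.elim⟩
    · rintro S T hST ⟨R, hR, hR1, C, hC, h⟩
      exact ⟨R, hR, hR1, C, hC, fun R' hR' x hx => h R' hR' x (hST hx)⟩
    · rintro S T ⟨R, hR, hR1, C, hC, h⟩ ⟨R₂, hR₂, -, C₂, -, h₂⟩
      refine ⟨min R R₂, lt_min hR hR₂, (min_le_left _ _).trans hR1, max C C₂,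
        hC.trans (le_max_left _ _), fun R' hR' x hx => ?_⟩
      rcases hx with hx | hx
      · exact (h R' (hR'.trans (min_le_left _ _)) x hx).mono (le_max_left _ _)
      · exact (h₂ R' (hR'.trans (min_le_right _ _)) x hx).mono (le_max_right _ _)
    · intro x₀ _
      obtain ⟨R₀, hR₀, hR₀1, C, hC, h⟩ := hdef E hEm hEp x₀
      exact ⟨ball x₀ (R₀ / 2), mem_nhdsWithin_of_mem_nhds (ball_mem_nhds _ (half_pos hR₀)),
        R₀ / 2, half_pos hR₀, by linarith, C, hC,
        fun R' hR' x hx => h.of_mem_ball hEm hEp hx hR'⟩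
  obtain ⟨R, hR, hR1, C, hC, h⟩ := hloc
  have hB' (x : X) (hx : x ∈ B) : DeformIneq m E x R C := h R le_rfl x (subset_closure hx)
  refine ⟨⟨R, hR, hR1, C, hC, hB'⟩, R, hR, fun x hx => ?_⟩
  exact le_csSup ⟨1, fun _ hR' => hR'.2.1⟩ ⟨hR, hR1, C, hC, hB' x hx⟩

end
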